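/- arXiv:1409.1286 — 4 statements merged into one kernel-verified Lean document; each statement's English description precedes it below -/
import Mathlib

section
/- For every ε > 0 there is a constant C_ε such that for every λ > 0 and every toral eigenfunction f with eigenvalue λ², i.e. every function of the form f(x) = Σ_{ℓ ∈ ℤ², |ℓ| = λ} a_ℓ e^{i⟨x,ℓ⟩} with complex coefficients a_ℓ, one has ‖f‖_{L⁴([0,2π]²)} ≤ C_ε λ^{ε} ‖f‖_{L²([0,2π]²)}. -/
open MeasureTheory Real

noncomputable section

/-- The character `x ↦ e^{i⟨x,k⟩}` of the torus. -/
def toralChar (k : ℤ × ℤ) (x : ℝ × ℝ) : ℂ :=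
  Complex.exp (((x.1 * k.1 + x.2 * k.2 : ℝ) : ℂ) * Complex.I)

/-- The fundamental domain `[0,2π]²`. -/
def toralSquare : Set (ℝ × ℝ) := Set.Icc (0 : ℝ) (2 * π) ×ˢ Set.Icc (0 : ℝ) (2 * π)

lemma continuous_toralChar (k : ℤ × ℤ) : Continuous (toralChar k) := by
  unfold toralChar
  fun_prop

lemma toralChar_mul_conj (k l : ℤ × ℤ) (x : ℝ × ℝ) :
    toralChar k x * (starRingEnd ℂ) (toralChar l x) = toralChar (k - l) x := by
  simp only [toralChar, ← Complex.exp_conj, ← Complex.exp_add, map_mul, Complex.conj_ofReal,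
    Complex.conj_I]
  congr 1
  push_cast [Prod.fst_sub, Prod.snd_sub]
  ring

lemma integrableOn_toralSquare {E : Type*} [NormedAddCommGroup E] {g : ℝ × ℝ → E}
    (hg : Continuous g) : IntegrableOn g toralSquare :=
  hg.continuousOn.integrableOn_compact (isCompact_Icc.prod isCompact_Icc)

lemma integral_Icc_exp_int_mul (n : ℤ) :
    ∫ t in Set.Icc (0 : ℝ) (2 * π), Complex.exp (((t * n : ℝ) : ℂ) * Complex.I)
      = if n = 0 then ((2 * π : ℝ) : ℂ) else 0 := by
  rw [integral_Icc_eq_integral_Ioc, ← intervalIntegral.integral_of_le (by positivity)]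
  split_ifs with hn
  · simp [hn]
  · have hc : (n : ℂ) * Complex.I ≠ 0 := by simp [hn]
    have hfun : ∀ t : ℝ, Complex.exp (((t * n : ℝ) : ℂ) * Complex.I)
        = Complex.exp ((n : ℂ) * Complex.I * t) := by
      intro t
      push_cast
      ring_nf
    simp only [hfun]
    rw [integral_exp_mul_complex hc]
    have h1 : Complex.exp ((n : ℂ) * Complex.I * ((2 * π : ℝ) : ℂ)) = 1 := by
      rw [← Complex.exp_int_mul_two_pi_mul_I n]
      push_cast
      ring_nf
    rw [h1]
    simp

lemma integral_toralChar (k : ℤ × ℤ) :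
    ∫ x in toralSquare, toralChar k x = if k = 0 then (((2 * π) ^ 2 : ℝ) : ℂ) else 0 := by
  have hsplit : ∀ x : ℝ × ℝ, toralChar k x =
      Complex.exp (((x.1 * k.1 : ℝ) : ℂ) * Complex.I) *
        Complex.exp (((x.2 * k.2 : ℝ) : ℂ) * Complex.I) := by
    intro x
    rw [toralChar, ← Complex.exp_add]
    push_cast
    ring_nf
  simp only [hsplit, toralSquare]
  rw [Measure.volume_eq_prod, setIntegral_prod_mul
    (fun t : ℝ => Complex.exp (((t * k.1 : ℝ) : ℂ) * Complex.I))
    (fun t : ℝ => Complex.exp (((t * k.2 : ℝ) : ℂ) * Complex.I)),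
    integral_Icc_exp_int_mul, integral_Icc_exp_int_mul]
  simp only [Prod.ext_iff, Prod.fst_zero, Prod.snd_zero]
  split_ifs <;> simp_all [sq]

/-- Parseval's identity for trigonometric polynomials on the two-dimensional torus. -/
lemma integral_norm_sq_sum_toralChar (T : Finset (ℤ × ℤ)) (c : ℤ × ℤ → ℂ) :
    ∫ x in toralSquare, ‖∑ m ∈ T, c m * toralChar m x‖ ^ 2
      = (2 * π) ^ 2 * ∑ m ∈ T, ‖c m‖ ^ 2 := by
  have hexpand : ∀ x : ℝ × ℝ, ((‖∑ m ∈ T, c m * toralChar m x‖ ^ 2 : ℝ) : ℂ)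
      = ∑ m ∈ T, ∑ n ∈ T, c m * (starRingEnd ℂ) (c n) * toralChar (m - n) x := by
    intro x
    rw [Complex.ofReal_pow, ← Complex.mul_conj', map_sum, Finset.sum_mul_sum]
    refine Finset.sum_congr rfl fun m _ => Finset.sum_congr rfl fun n _ => ?_
    rw [← toralChar_mul_conj, map_mul]
    ring
  apply Complex.ofReal_injective
  rw [← integral_complex_ofReal]
  simp only [hexpand]
  have hcont : ∀ m n, Continuous fun x =>
      c m * (starRingEnd ℂ) (c n) * toralChar (m - n) x := fun m n =>
    continuous_const.mul (continuous_toralChar _)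
  rw [integral_finsetSum _ fun m _ => integrableOn_toralSquare
    (continuous_finsetSum _ fun n _ => hcont m n)]
  simp only [Complex.ofReal_mul, Complex.ofReal_sum, Finset.mul_sum]
  refine Finset.sum_congr rfl fun m hm => ?_
  rw [integral_finsetSum _ fun n _ => integrableOn_toralSquare (hcont m n)]
  simp only [integral_const_mul, integral_toralChar, sub_eq_zero]
  rw [Finset.sum_eq_single_of_mem m hm (fun n _ hn => by simp [hn.symm]), if_pos rfl,
    Complex.mul_conj']
  push_cast
  ring

lemma normSq_pos {m : ℤ × ℤ} (hm : m ≠ 0) : 0 < m.1 ^ 2 + m.2 ^ 2 := by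
  rcases eq_or_ne m.1 0 with h1 | h1
  · have h2 : m.2 ≠ 0 := fun h2 => hm (Prod.ext h1 h2)
    positivity
  · positivity

/-- Two integer points on a common circle around the origin and on a common line orthogonal to `m`
are equal or symmetric about the line through the origin spanned by `m`. -/
lemma eq_or_reflected_of_circle_of_line {u v m : ℤ × ℤ} (hm : m ≠ 0)
    (hcirc : u.1 ^ 2 + u.2 ^ 2 = v.1 ^ 2 + v.2 ^ 2)
    (hline : u.1 * m.1 + u.2 * m.2 = v.1 * m.1 + v.2 * m.2) :
    u = v ∨ m.1 * (u.2 + v.2) = m.2 * (u.1 + v.1) := by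
  have hpos := normSq_pos hm
  have hprod : (m.1 * (u.2 - v.2) - m.2 * (u.1 - v.1)) *
      (m.1 * (u.2 + v.2) - m.2 * (u.1 + v.1)) = 0 := by
    linear_combination (m.1 ^ 2 + m.2 ^ 2) * hcirc
      - (u.1 * m.1 + u.2 * m.2 + v.1 * m.1 + v.2 * m.2) * hline
  rcases mul_eq_zero.mp hprod with h | h
  · left
    ext
    · refine mul_left_cancel₀ hpos.ne' ?_
      linear_combination m.1 * hline - m.2 * h
    · refine mul_left_cancel₀ hpos.ne' ?_
      linear_combination m.2 * hline + m.1 * h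
  · right
    linarith

/-- A nonzero vector is a difference of two integer points of a given circle in at most two
ways. -/
lemma card_filter_sub_eq_le_two {S : Finset (ℤ × ℤ)} {N : ℤ}
    (hS : ∀ ℓ ∈ S, ℓ.1 ^ 2 + ℓ.2 ^ 2 = N) {m : ℤ × ℤ} (hm : m ≠ 0) :
    ((S ×ˢ S).filter fun p => p.1 - p.2 = m).card ≤ 2 := by
  by_contra! hcard
  obtain ⟨p, hp, q, hq, r, hr, hpq, hpr, hqr⟩ := Finset.two_lt_card.mp hcard
  simp only [Finset.mem_filter, Finset.mem_product] at hp hq hr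
  have hline : ∀ p : (ℤ × ℤ) × (ℤ × ℤ), (p.1 ∈ S ∧ p.2 ∈ S) ∧ p.1 - p.2 = m →
      2 * (p.1.1 * m.1 + p.1.2 * m.2) = m.1 ^ 2 + m.2 ^ 2 := by
    rintro p ⟨⟨h1, h2⟩, rfl⟩
    have h1' := hS _ h1
    have h2' := hS _ h2
    simp only [Prod.fst_sub, Prod.snd_sub]
    linear_combination h1' - h2'
  have hfst : ∀ p q : (ℤ × ℤ) × (ℤ × ℤ), p.1 - p.2 = m → q.1 - q.2 = m → p.1 = q.1 → p = q := by
    intro p q hp hq h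
    refine Prod.ext h ?_
    rw [← hq, h] at hp
    exact sub_right_injective hp
  have hp' := hline p hp
  have hq' := hline q hq
  have hr' := hline r hr
  have hcp := hS _ hp.1.1
  have hcq := hS _ hq.1.1
  have hcr := hS _ hr.1.1
  have h1 := (eq_or_reflected_of_circle_of_line hm (hcp.trans hcq.symm) (by linarith)).resolve_left
    fun h => hpq (hfst p q hp.2 hq.2 h)
  have h2 := (eq_or_reflected_of_circle_of_line hm (hcp.trans hcr.symm) (by linarith)).resolve_left
    fun h => hpr (hfst p r hp.2 hr.2 h)
  have hpos : 2 * (m.1 ^ 2 + m.2 ^ 2) ≠ 0 := mul_ne_zero two_ne_zero (normSq_pos hm).ne'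
  refine hqr (hfst q r hq.2 hr.2 (Prod.ext ?_ ?_))
  · refine mul_left_cancel₀ hpos ?_
    linear_combination m.1 * (hq' - hr') - 2 * m.2 * (h1 - h2)
  · refine mul_left_cancel₀ hpos ?_
    linear_combination m.2 * (hq' - hr') + 2 * m.1 * (h1 - h2)

/-- The Fourier coefficient of `|f|²` at `m`, where `f = ∑ ℓ ∈ S, a ℓ e^{i⟨x,ℓ⟩}`. -/
def normSqCoeff (S : Finset (ℤ × ℤ)) (a : ℤ × ℤ → ℂ) (m : ℤ × ℤ) : ℂ :=
  ∑ p ∈ (S ×ˢ S).filter (fun p => p.1 - p.2 = m), a p.1 * (starRingEnd ℂ) (a p.2)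

lemma norm_pow_four_eq (S : Finset (ℤ × ℤ)) (a : ℤ × ℤ → ℂ) (x : ℝ × ℝ) :
    ‖∑ ℓ ∈ S, a ℓ * toralChar ℓ x‖ ^ 4 =
      ‖∑ m ∈ (S ×ˢ S).image (fun p => p.1 - p.2), normSqCoeff S a m * toralChar m x‖ ^ 2 := by
  have hconv : ∑ m ∈ (S ×ˢ S).image (fun p => p.1 - p.2), normSqCoeff S a m * toralChar m x
      = (∑ ℓ ∈ S, a ℓ * toralChar ℓ x) * (starRingEnd ℂ) (∑ ℓ ∈ S, a ℓ * toralChar ℓ x) := by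
    rw [map_sum, Finset.sum_mul_sum, ← Finset.sum_product',
      ← Finset.sum_fiberwise_of_maps_to (g := fun p : (ℤ × ℤ) × (ℤ × ℤ) => p.1 - p.2)
        (fun p hp => Finset.mem_image_of_mem _ hp)]
    refine Finset.sum_congr rfl fun m _ => ?_
    rw [normSqCoeff, Finset.sum_mul]
    refine Finset.sum_congr rfl fun p hp => ?_
    rw [← (Finset.mem_filter.mp hp).2, ← toralChar_mul_conj, map_mul]
    ring
  rw [hconv, norm_mul, RCLike.norm_conj]
  ring

lemma norm_normSqCoeff_zero_sq (S : Finset (ℤ × ℤ)) (a : ℤ × ℤ → ℂ) :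
    ‖normSqCoeff S a 0‖ ^ 2 ≤ (∑ ℓ ∈ S, ‖a ℓ‖ ^ 2) ^ 2 := by
  have hdiag : ((S ×ˢ S).filter fun p => p.1 - p.2 = 0) = S.diag := by
    ext p
    simp only [Finset.mem_filter, Finset.mem_product, Finset.mem_diag, sub_eq_zero]
    grind
  gcongr
  rw [normSqCoeff, hdiag, Finset.sum_diag]
  refine (norm_sum_le _ _).trans (Finset.sum_le_sum fun ℓ _ => ?_)
  rw [norm_mul, RCLike.norm_conj, sq]

lemma norm_normSqCoeff_sq_le {S : Finset (ℤ × ℤ)} {N : ℤ}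
    (hS : ∀ ℓ ∈ S, ℓ.1 ^ 2 + ℓ.2 ^ 2 = N) (a : ℤ × ℤ → ℂ) {m : ℤ × ℤ} (hm : m ≠ 0) :
    ‖normSqCoeff S a m‖ ^ 2 ≤
      2 * ∑ p ∈ (S ×ˢ S).filter (fun p => p.1 - p.2 = m), ‖a p.1‖ ^ 2 * ‖a p.2‖ ^ 2 := by
  calc ‖normSqCoeff S a m‖ ^ 2
      ≤ (∑ p ∈ (S ×ˢ S).filter (fun p => p.1 - p.2 = m), ‖a p.1‖ * ‖a p.2‖) ^ 2 := by
        gcongr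
        refine (norm_sum_le _ _).trans (Finset.sum_le_sum fun p _ => ?_)
        rw [norm_mul, RCLike.norm_conj]
    _ ≤ ((S ×ˢ S).filter (fun p => p.1 - p.2 = m)).card *
        ∑ p ∈ (S ×ˢ S).filter (fun p => p.1 - p.2 = m), (‖a p.1‖ * ‖a p.2‖) ^ 2 :=
        sq_sum_le_card_mul_sum_sq
    _ ≤ 2 * ∑ p ∈ (S ×ˢ S).filter (fun p => p.1 - p.2 = m), ‖a p.1‖ ^ 2 * ‖a p.2‖ ^ 2 := by
        simp only [mul_pow]
        gcongr
        exact_mod_cast card_filter_sub_eq_le_two hS hm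

lemma sum_norm_normSqCoeff_sq_le {S : Finset (ℤ × ℤ)} {N : ℤ}
    (hS : ∀ ℓ ∈ S, ℓ.1 ^ 2 + ℓ.2 ^ 2 = N) (a : ℤ × ℤ → ℂ) :
    ∑ m ∈ (S ×ˢ S).image (fun p => p.1 - p.2), ‖normSqCoeff S a m‖ ^ 2
      ≤ 3 * (∑ ℓ ∈ S, ‖a ℓ‖ ^ 2) ^ 2 := by
  set T := (S ×ˢ S).image (fun p => p.1 - p.2)
  set A := ∑ ℓ ∈ S, ‖a ℓ‖ ^ 2
  calc ∑ m ∈ T, ‖normSqCoeff S a m‖ ^ 2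
      ≤ ∑ m ∈ T, ((if m = 0 then A ^ 2 else 0) +
          2 * ∑ p ∈ (S ×ˢ S).filter (fun p => p.1 - p.2 = m), ‖a p.1‖ ^ 2 * ‖a p.2‖ ^ 2) := by
        refine Finset.sum_le_sum fun m _ => ?_
        split_ifs with hm
        · subst hm
          exact (norm_normSqCoeff_zero_sq S a).trans (le_add_of_nonneg_right (by positivity))
        · rw [zero_add]
          exact norm_normSqCoeff_sq_le hS a hm
    _ ≤ A ^ 2 + 2 * A ^ 2 := by
        rw [Finset.sum_add_distrib, ← Finset.mul_sum, Finset.sum_fiberwise_of_maps_to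
          (fun p hp => Finset.mem_image_of_mem _ hp), Finset.sum_product]
        simp only
        rw [← Finset.sum_mul_sum, ← sq, Finset.sum_ite_eq']
        gcongr
        split_ifs
        · exact le_rfl
        · positivity
    _ = 3 * A ^ 2 := by ring

/-- **Cooke–Zygmund**: the `L⁴` norm of a toral eigenfunction is bounded by its `L²` norm. -/
lemma integral_norm_pow_four_le {S : Finset (ℤ × ℤ)} {N : ℤ}
    (hS : ∀ ℓ ∈ S, ℓ.1 ^ 2 + ℓ.2 ^ 2 = N) (a : ℤ × ℤ → ℂ) :
    ∫ x in toralSquare, ‖∑ ℓ ∈ S, a ℓ * toralChar ℓ x‖ ^ 4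
      ≤ 3 * (∫ x in toralSquare, ‖∑ ℓ ∈ S, a ℓ * toralChar ℓ x‖ ^ 2) ^ 2 := by
  simp only [norm_pow_four_eq, integral_norm_sq_sum_toralChar]
  have hvol : 1 ≤ 2 * π := by linarith [pi_gt_three]
  calc (2 * π) ^ 2 * ∑ m ∈ (S ×ˢ S).image (fun p => p.1 - p.2), ‖normSqCoeff S a m‖ ^ 2
      ≤ (2 * π) ^ 2 * (3 * (∑ ℓ ∈ S, ‖a ℓ‖ ^ 2) ^ 2) := by
        gcongr
        exact sum_norm_normSqCoeff_sq_le hS a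
    _ ≤ ((2 * π) ^ 2) ^ 2 * (3 * (∑ ℓ ∈ S, ‖a ℓ‖ ^ 2) ^ 2) := by
        gcongr
        exact le_self_pow₀ hvol two_ne_zero
    _ = 3 * ((2 * π) ^ 2 * ∑ ℓ ∈ S, ‖a ℓ‖ ^ 2) ^ 2 := by ring

/-- For every `ε > 0` there is `C_ε` so that every toral eigenfunction
`f(x) = Σ_{ℓ ∈ ℤ², |ℓ| = λ} a_ℓ e^{i⟨x,ℓ⟩}` satisfies
`‖f‖_{L⁴([0,2π]²)} ≤ C_ε λ^ε ‖f‖_{L²([0,2π]²)}`. -/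
theorem toral_eigenfunction_L4_eps :
    ∀ ε : ℝ, 0 < ε → ∃ Cε : ℝ, 0 < Cε ∧
      ∀ lam : ℝ, 0 < lam →
      ∀ S : Finset (ℤ × ℤ), (∀ ℓ ∈ S, ((ℓ.1 : ℝ)) ^ 2 + ((ℓ.2 : ℝ)) ^ 2 = lam ^ 2) →
      ∀ a : ℤ × ℤ → ℂ,
        (∫ x in (Set.Icc (0 : ℝ) (2 * π)) ×ˢ (Set.Icc (0 : ℝ) (2 * π)),
            ‖∑ ℓ ∈ S, a ℓ *
              Complex.exp (((x.1 * ℓ.1 + x.2 * ℓ.2 : ℝ) : ℂ) * Complex.I)‖ ^ 4) ^ ((1 : ℝ) / 4)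
          ≤ Cε * lam ^ ε *
            (∫ x in (Set.Icc (0 : ℝ) (2 * π)) ×ˢ (Set.Icc (0 : ℝ) (2 * π)),
              ‖∑ ℓ ∈ S, a ℓ *
                Complex.exp (((x.1 * ℓ.1 + x.2 * ℓ.2 : ℝ) : ℂ) * Complex.I)‖ ^ 2) ^ ((1 : ℝ) / 2) := by
  intro ε hε
  refine ⟨3, by norm_num, fun lam hlam S hS a => ?_⟩
  rcases S.eq_empty_or_nonempty with rfl | ⟨ℓ₀, hℓ₀⟩
  · simp
  have hint : ∀ ℓ ∈ S, ℓ.1 ^ 2 + ℓ.2 ^ 2 = ℓ₀.1 ^ 2 + ℓ₀.2 ^ 2 := fun ℓ hℓ => by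
    exact_mod_cast (hS ℓ hℓ).trans (hS ℓ₀ hℓ₀).symm
  have hlam1 : 1 ≤ lam := by
    have hpos : 0 < ℓ₀.1 ^ 2 + ℓ₀.2 ^ 2 := by
      have h := hS ℓ₀ hℓ₀ ▸ pow_pos hlam 2
      exact_mod_cast h
    have hone : (1 : ℝ) ≤ lam ^ 2 := by
      rw [← hS ℓ₀ hℓ₀]
      exact_mod_cast hpos
    exact (one_le_sq_iff₀ hlam.le).mp hone
  have hmain := integral_norm_pow_four_le hint a
  change (∫ x in toralSquare, ‖∑ ℓ ∈ S, a ℓ * toralChar ℓ x‖ ^ 4) ^ ((1 : ℝ) / 4) ≤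
    3 * lam ^ ε * (∫ x in toralSquare, ‖∑ ℓ ∈ S, a ℓ * toralChar ℓ x‖ ^ 2) ^ ((1 : ℝ) / 2)
  have hI4 : 0 ≤ ∫ x in toralSquare, ‖∑ ℓ ∈ S, a ℓ * toralChar ℓ x‖ ^ 4 :=
    integral_nonneg fun x => by positivity
  have hI2 : 0 ≤ ∫ x in toralSquare, ‖∑ ℓ ∈ S, a ℓ * toralChar ℓ x‖ ^ 2 :=
    integral_nonneg fun x => by positivity
  generalize (∫ x in toralSquare, ‖∑ ℓ ∈ S, a ℓ * toralChar ℓ x‖ ^ 4) = I4 at *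
  generalize (∫ x in toralSquare, ‖∑ ℓ ∈ S, a ℓ * toralChar ℓ x‖ ^ 2) = I2 at *
  calc I4 ^ ((1 : ℝ) / 4) ≤ (3 * I2 ^ 2) ^ ((1 : ℝ) / 4) := by gcongr
    _ = 3 ^ ((1 : ℝ) / 4) * I2 ^ ((1 : ℝ) / 2) := by
        rw [mul_rpow (by norm_num) (by positivity), ← rpow_natCast, ← rpow_mul hI2]
        norm_num
    _ ≤ 3 * lam ^ ε * I2 ^ ((1 : ℝ) / 2) := by
        gcongr
        calc (3 : ℝ) ^ ((1 : ℝ) / 4) ≤ 3 ^ (1 : ℝ) :=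
              rpow_le_rpow_of_exponent_le (by norm_num) (by norm_num)
          _ ≤ 3 * lam ^ ε := by
              rw [rpow_one]
              exact le_mul_of_one_le_right (by norm_num) (one_le_rpow hlam1 hε.le)

end
end

section
/- For every ε > 0 there is a constant C_ε such that for every λ ≥ 1, every toral eigenfunction f with eigenvalue λ² (i.e. f(x) = Σ_{ℓ ∈ ℤ², |ℓ| = λ} a_ℓ e^{i⟨x,ℓ⟩} with complex coefficients a_ℓ), every x₀ ∈ ℝ² and every unit vector v ∈ ℝ², one has ∫_0^1 |f(x₀ + t v)|² dt ≤ C_ε λ^{ε} ∫_{[0,2π]²} |f(x)|² dx. -/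
open MeasureTheory Real

noncomputable section

/-- For each `δ > 0`, `e + 1 ≤ N ^ (δ e)` for all large `N`, and up to a constant for all `N ≥ 2`. -/
lemma exists_add_one_le_mul_rpow_pow {δ : ℝ} (hδ : 0 < δ) :
    ∃ A K : ℝ, 1 ≤ A ∧ ∀ N : ℝ, 2 ≤ N → ∀ e : ℕ,
      (e : ℝ) + 1 ≤ (if N < K then A else 1) * (N ^ δ) ^ e := by
  obtain ⟨h, hh⟩ : ∃ h : ℝ, (2 : ℝ) ^ δ = 1 + h := ⟨2 ^ δ - 1, by ring⟩
  have hpos : 0 < h := by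
    have := Real.one_lt_rpow (x := 2) (by norm_num) hδ
    linarith
  refine ⟨max 1 h⁻¹, 2 ^ δ⁻¹, le_max_left _ _, fun N hN e => ?_⟩
  split_ifs with hNK
  · have h1 : 1 + (e : ℝ) * h ≤ (N ^ δ) ^ e :=
      calc 1 + (e : ℝ) * h ≤ (1 + h) ^ e := one_add_mul_le_pow (by linarith) e
        _ ≤ (N ^ δ) ^ e := by
          rw [← hh]
          gcongr
    have h2 : (e : ℝ) ≤ max 1 h⁻¹ * ((e : ℝ) * h) :=
      calc (e : ℝ) = h⁻¹ * ((e : ℝ) * h) := by field_simp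
        _ ≤ _ := by gcongr; exact le_max_right _ _
    calc (e : ℝ) + 1 ≤ max 1 h⁻¹ * (1 + (e : ℝ) * h) := by
          have := le_max_left 1 h⁻¹
          linarith
      _ ≤ _ := by gcongr
  · have h2 : (2 : ℝ) ≤ N ^ δ :=
      calc (2 : ℝ) = (2 ^ δ⁻¹) ^ δ := by
            rw [← Real.rpow_mul (by norm_num), inv_mul_cancel₀ hδ.ne', Real.rpow_one]
        _ ≤ N ^ δ := by
            have := not_lt.1 hNK
            gcongr
    calc (e : ℝ) + 1 = 1 + (e : ℝ) * 1 := by ring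
      _ ≤ (1 + 1) ^ e := one_add_mul_le_pow (by norm_num) e
      _ ≤ 1 * (N ^ δ) ^ e := by
          rw [one_mul]
          gcongr
          linarith

lemma GaussianInt.norm_eq_sq_add_sq (z : GaussianInt) : z.norm = z.re ^ 2 + z.im ^ 2 := by
  rw [Zsqrtd.norm_def]
  ring

lemma GaussianInt.finite_norm_le (K : ℝ) : {z : GaussianInt | (z.norm : ℝ) ≤ K}.Finite := by
  have hinj : Function.Injective fun z : GaussianInt => (z.re, z.im) := fun z w h =>
    Zsqrtd.ext (Prod.ext_iff.1 h).1 (Prod.ext_iff.1 h).2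
  refine Set.Finite.of_finite_image (f := fun z : GaussianInt => (z.re, z.im))
    (((Set.finite_Icc (-⌊K⌋) ⌊K⌋).prod (Set.finite_Icc (-⌊K⌋) ⌊K⌋)).subset ?_) hinj.injOn
  rintro _ ⟨z, hz, rfl⟩
  have hz' : z.norm ≤ ⌊K⌋ := Int.le_floor.2 hz
  rw [GaussianInt.norm_eq_sq_add_sq] at hz'
  have key : ∀ a : ℤ, a ≤ a ^ 2 ∧ -a ≤ a ^ 2 := fun a =>
    ⟨Int.le_self_sq a, by simpa using Int.le_self_sq (-a)⟩
  have h1 := key z.re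
  have h2 := key z.im
  have h3 := sq_nonneg z.re
  have h4 := sq_nonneg z.im
  simp only [Set.mem_prod, Set.mem_Icc]
  omega

lemma GaussianInt.two_le_norm_of_prime {p : GaussianInt} (hp : Prime p) : (2 : ℝ) ≤ p.norm := by
  have h0 : 0 < p.norm := GaussianInt.norm_pos.2 hp.ne_zero
  have h1 : p.norm ≠ 1 := fun h => hp.not_isUnit (Zsqrtd.norm_eq_one_iff.1 (by simp [h]))
  have h2 : 2 ≤ p.norm := by omega
  exact_mod_cast h2

open UniqueFactorizationMonoid in
/-- The divisor bound in `ℤ[i]`. -/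
lemma GaussianInt.exists_card_divisors_le {δ : ℝ} (hδ : 0 < δ) :
    ∃ C : ℝ, 0 < C ∧ ∀ w : GaussianInt, w ≠ 0 → ∀ S : Finset GaussianInt, (∀ z ∈ S, z ∣ w) →
      (S.card : ℝ) ≤ C * (w.norm : ℝ) ^ δ := by
  classical
  let _ : StrongNormalizationMonoid GaussianInt :=
    UniqueFactorizationMonoid.strongNormalizationMonoid
  obtain ⟨A, K, hA, hAK⟩ := exists_add_one_le_mul_rpow_pow hδ
  let P := (GaussianInt.finite_norm_le K).toFinset
  let U := (GaussianInt.finite_norm_le 1).toFinset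
  refine ⟨(U.card + 1) * A ^ P.card, by positivity, fun w hw S hS => ?_⟩
  have hS0 : ∀ z ∈ S, z ≠ 0 := fun z hz h => hw (zero_dvd_iff.1 (h ▸ hS z hz))
  have hfib : S.card ≤ U.card * (S.image normalizedFactors).card := by
    refine Finset.card_le_mul_card_image S _ fun b hb => ?_
    obtain ⟨z, hz, rfl⟩ := Finset.mem_image.1 hb
    refine (Finset.card_le_card (t := U.image (z * ·)) fun y hy => ?_).trans Finset.card_image_le
    obtain ⟨hyS, hy⟩ := Finset.mem_filter.1 hy
    obtain ⟨u, rfl⟩ := (associated_iff_normalizedFactors_eq_normalizedFactors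
      (hS0 z hz) (hS0 y hyS)).2 hy.symm
    refine Finset.mem_image.2 ⟨u, ?_, rfl⟩
    have hu : (u : GaussianInt).norm = 1 := by
      have h1 := Zsqrtd.norm_eq_one_iff.2 u.isUnit
      have h2 := GaussianInt.norm_nonneg (u : GaussianInt)
      omega
    exact (GaussianInt.finite_norm_le 1).mem_toFinset.2
      (show ((u : GaussianInt).norm : ℝ) ≤ 1 by rw [hu, Int.cast_one])
  have himg : (S.image normalizedFactors).card ≤ (Finset.Iic (normalizedFactors w)).card := by
    refine Finset.card_le_card fun b hb => ?_
    obtain ⟨z, hz, rfl⟩ := Finset.mem_image.1 hb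
    exact Finset.mem_Iic.2
      ((dvd_iff_normalizedFactors_le_normalizedFactors (hS0 z hz) hw).1 (hS z hz))
  set T := (normalizedFactors w).toFinset
  have hT : ∀ p ∈ T, (2 : ℝ) ≤ p.norm := fun p hp =>
    GaussianInt.two_le_norm_of_prime (prime_of_normalized_factor p (Multiset.mem_toFinset.1 hp))
  have hnorm : ∏ p ∈ T, (p.norm : ℝ) ^ (normalizedFactors w).count p = w.norm := by
    obtain ⟨u, hu⟩ := prod_normalizedFactors hw
    have h1 : (u : GaussianInt).norm = 1 := by
      have h1 := Zsqrtd.norm_eq_one_iff.2 u.isUnit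
      have h2 := GaussianInt.norm_nonneg (u : GaussianInt)
      omega
    have h2 : w.norm = (normalizedFactors w).prod.norm := by
      conv_lhs => rw [← hu, Zsqrtd.norm_mul, h1, mul_one]
    have h3 : (normalizedFactors w).prod.norm
        = ∏ p ∈ T, p.norm ^ (normalizedFactors w).count p := by
      rw [Finset.prod_multiset_count]
      exact (map_prod Zsqrtd.normMonoidHom _ _).trans
        (Finset.prod_congr rfl fun p _ => map_pow Zsqrtd.normMonoidHom _ _)
    rw [h2, h3]
    push_cast
    rfl
  have hsmall : ∏ p ∈ T, (if (p.norm : ℝ) < K then A else 1) ≤ A ^ P.card := by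
    rw [← Finset.prod_filter, Finset.prod_const]
    refine pow_le_pow_right₀ hA (Finset.card_le_card fun p hp => ?_)
    simpa [P] using (Finset.mem_filter.1 hp).2.le
  have hprod : ((Finset.Iic (normalizedFactors w)).card : ℝ) ≤ A ^ P.card * (w.norm : ℝ) ^ δ := by
    rw [Multiset.card_Iic]
    push_cast
    calc ∏ p ∈ T, (((normalizedFactors w).count p : ℝ) + 1)
        ≤ ∏ p ∈ T, ((if (p.norm : ℝ) < K then A else 1) *
            ((p.norm : ℝ) ^ δ) ^ (normalizedFactors w).count p) :=
          Finset.prod_le_prod (fun p _ => by positivity) fun p hp => hAK _ (hT p hp) _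
      _ = (∏ p ∈ T, (if (p.norm : ℝ) < K then A else 1)) * (w.norm : ℝ) ^ δ := by
          rw [Finset.prod_mul_distrib, ← hnorm, ← Real.finsetProd_rpow]
          · congr 1
            refine Finset.prod_congr rfl fun p hp => ?_
            exact Real.rpow_pow_comm (by linarith [hT p hp]) _ _
          · intro p hp
            have := hT p hp
            positivity
      _ ≤ _ := by
          have : (0 : ℝ) ≤ w.norm := by exact_mod_cast GaussianInt.norm_nonneg w
          gcongr
  have h0 : (0 : ℝ) ≤ A ^ P.card * (w.norm : ℝ) ^ δ := le_trans (by positivity) hprod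
  calc (S.card : ℝ) ≤ U.card * (S.image normalizedFactors).card := by exact_mod_cast hfib
    _ ≤ U.card * (A ^ P.card * (w.norm : ℝ) ^ δ) := by
        gcongr
        exact le_trans (by exact_mod_cast himg) hprod
    _ ≤ (U.card + 1) * (A ^ P.card * (w.norm : ℝ) ^ δ) := by
        gcongr
        linarith
    _ = _ := by ring

/-- The number of lattice points on a circle of radius `lam` is `O(lam ^ ε)`. -/
lemma exists_card_latticePoints_circle_le {ε : ℝ} (hε : 0 < ε) :
    ∃ C : ℝ, 0 < C ∧ ∀ lam : ℝ, 1 ≤ lam → ∀ S : Finset (ℤ × ℤ),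
      (∀ ℓ ∈ S, ((ℓ.1 : ℝ)) ^ 2 + ((ℓ.2 : ℝ)) ^ 2 = lam ^ 2) → (S.card : ℝ) ≤ C * lam ^ ε := by
  obtain ⟨C, hC, h⟩ := GaussianInt.exists_card_divisors_le (δ := ε / 4) (by positivity)
  refine ⟨C, hC, fun lam hlam S hS => ?_⟩
  rcases S.eq_empty_or_nonempty with rfl | ⟨ℓ₀, hℓ₀⟩
  · rw [Finset.card_empty, Nat.cast_zero]
    positivity
  let g : ℤ × ℤ ↪ GaussianInt :=
    ⟨fun ℓ => ⟨ℓ.1, ℓ.2⟩, fun a b hab =>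
      Prod.ext (congrArg Zsqrtd.re hab) (congrArg Zsqrtd.im hab)⟩
  have hg : ∀ ℓ ∈ S, ((g ℓ).norm : ℝ) = lam ^ 2 := fun ℓ hℓ => by
    rw [GaussianInt.norm_eq_sq_add_sq, ← hS ℓ hℓ, Int.cast_add, Int.cast_pow, Int.cast_pow]
    rfl
  have hg' : ∀ ℓ ∈ S, (g ℓ).norm = (g ℓ₀).norm := fun ℓ hℓ => by
    exact_mod_cast (hg ℓ hℓ).trans (hg ℓ₀ hℓ₀).symm
  have hpos : (0 : ℝ) < (g ℓ₀).norm := by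
    rw [hg ℓ₀ hℓ₀]
    positivity
  have key := h ((g ℓ₀).norm : GaussianInt) (by exact_mod_cast hpos.ne') (S.map g) (by
    intro z hz
    obtain ⟨ℓ, hℓ, rfl⟩ := Finset.mem_map.1 hz
    rw [← hg' ℓ hℓ, Zsqrtd.norm_eq_mul_conj]
    exact dvd_mul_right _ _)
  rw [Finset.card_map, Zsqrtd.norm_intCast] at key
  push_cast at key
  rw [hg ℓ₀ hℓ₀] at key
  convert key using 2
  rw [show lam ^ 2 * lam ^ 2 = lam ^ (4 : ℕ) by ring, ← Real.rpow_natCast,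
    ← Real.rpow_mul (by linarith)]
  congr 1
  push_cast
  ring

lemma setIntegral_exp_int_mul_I (k : ℤ) :
    ∫ x in Set.Icc (0 : ℝ) (2 * π), Complex.exp ((x * k : ℝ) * Complex.I)
      = if k = 0 then (2 * π : ℂ) else 0 := by
  rw [integral_Icc_eq_integral_Ioc,
    ← intervalIntegral.integral_of_le (by positivity : (0 : ℝ) ≤ 2 * π)]
  split_ifs with hk
  · simp [hk]
  · have hc : (k : ℂ) * Complex.I ≠ 0 := mul_ne_zero (by exact_mod_cast hk) Complex.I_ne_zero
    have h := integral_exp_mul_complex (a := 0) (b := 2 * π) hc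
    have h1 : Complex.exp ((k : ℂ) * Complex.I * ((2 * π : ℝ) : ℂ)) = 1 := by
      rw [← Complex.exp_int_mul_two_pi_mul_I k]
      congr 1
      push_cast
      ring
    rw [h1] at h
    simp only [Complex.ofReal_zero, mul_zero, Complex.exp_zero, sub_self, zero_div] at h
    rw [← h]
    congr 1
    ext x
    congr 1
    push_cast
    ring

/-- Parseval's identity for trigonometric polynomials on the two-dimensional torus. -/
lemma setIntegral_norm_sq_trigPoly (S : Finset (ℤ × ℤ)) (a : ℤ × ℤ → ℂ) :
    ∫ x in (Set.Icc (0 : ℝ) (2 * π)) ×ˢ (Set.Icc (0 : ℝ) (2 * π)),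
      ‖∑ ℓ ∈ S, a ℓ * Complex.exp (((x.1 * ℓ.1 + x.2 * ℓ.2 : ℝ) : ℂ) * Complex.I)‖ ^ 2
      = (2 * π) ^ 2 * ∑ ℓ ∈ S, ‖a ℓ‖ ^ 2 := by
  set Q := (Set.Icc (0 : ℝ) (2 * π)) ×ˢ (Set.Icc (0 : ℝ) (2 * π))
  have hexpand : ∀ x : ℝ × ℝ,
      ((‖∑ ℓ ∈ S, a ℓ * Complex.exp (((x.1 * ℓ.1 + x.2 * ℓ.2 : ℝ) : ℂ) * Complex.I)‖ ^ 2 : ℝ) : ℂ)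
      = ∑ ℓ ∈ S, ∑ m ∈ S, a ℓ * (starRingEnd ℂ) (a m) *
        (Complex.exp ((x.1 * (ℓ.1 - m.1 : ℤ) : ℝ) * Complex.I) *
          Complex.exp ((x.2 * (ℓ.2 - m.2 : ℤ) : ℝ) * Complex.I)) := fun x => by
    rw [Complex.ofReal_pow, ← Complex.mul_conj', map_sum, Finset.sum_mul_sum]
    refine Finset.sum_congr rfl fun ℓ _ => Finset.sum_congr rfl fun m _ => ?_
    rw [map_mul, ← Complex.exp_conj, map_mul, Complex.conj_I, Complex.conj_ofReal,
      mul_mul_mul_comm, ← Complex.exp_add, ← Complex.exp_add]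
    congr 2
    push_cast
    ring
  have hint : ∀ ℓ m : ℤ × ℤ, IntegrableOn (fun x : ℝ × ℝ => a ℓ * (starRingEnd ℂ) (a m) *
        (Complex.exp ((x.1 * (ℓ.1 - m.1 : ℤ) : ℝ) * Complex.I) *
          Complex.exp ((x.2 * (ℓ.2 - m.2 : ℤ) : ℝ) * Complex.I))) Q := fun ℓ m =>
    ContinuousOn.integrableOn_compact (isCompact_Icc.prod isCompact_Icc)
      (Continuous.continuousOn (by fun_prop))
  have hterm : ∀ ℓ m : ℤ × ℤ, ∫ x in Q, a ℓ * (starRingEnd ℂ) (a m) *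
        (Complex.exp ((x.1 * (ℓ.1 - m.1 : ℤ) : ℝ) * Complex.I) *
          Complex.exp ((x.2 * (ℓ.2 - m.2 : ℤ) : ℝ) * Complex.I))
      = if ℓ = m then (2 * π : ℂ) ^ 2 * (‖a ℓ‖ : ℂ) ^ 2 else 0 := fun ℓ m => by
    rw [integral_const_mul, Measure.volume_eq_prod, setIntegral_prod_mul
      (fun s : ℝ => Complex.exp ((s * (ℓ.1 - m.1 : ℤ) : ℝ) * Complex.I))
      (fun s : ℝ => Complex.exp ((s * (ℓ.2 - m.2 : ℤ) : ℝ) * Complex.I)),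
      setIntegral_exp_int_mul_I, setIntegral_exp_int_mul_I]
    simp only [sub_eq_zero, Prod.ext_iff]
    split_ifs with h1 h2 h3 h3
    · rw [← show ℓ = m from Prod.ext h1 h2, Complex.mul_conj']
      ring
    all_goals simp_all
  rw [← Complex.ofReal_inj, ← integral_complex_ofReal]
  simp_rw [hexpand]
  rw [integral_finsetSum _ fun ℓ _ => integrable_finsetSum _ fun m _ => hint ℓ m]
  rw [Finset.sum_congr rfl fun ℓ _ => integral_finsetSum _ fun m _ => hint ℓ m]
  simp_rw [hterm]
  push_cast
  rw [Finset.mul_sum]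
  exact Finset.sum_congr rfl fun ℓ hℓ => by rw [Finset.sum_ite_eq, if_pos hℓ]

/-- Geodesic restriction bound for toral eigenfunctions: for every `ε > 0` there is `C_ε`
such that for every eigenfunction `f(x) = Σ_{ℓ ∈ ℤ², |ℓ| = λ} a_ℓ e^{i⟨x,ℓ⟩}` with `λ ≥ 1`
and every unit segment `{x₀ + t v : t ∈ [0,1]}`,
`∫₀¹ |f(x₀ + tv)|² dt ≤ C_ε λ^ε ∫_{[0,2π]²} |f|²`. -/
theorem toral_restriction_bound :
    ∀ ε : ℝ, 0 < ε → ∃ Cε : ℝ, 0 < Cε ∧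
      ∀ lam : ℝ, 1 ≤ lam →
      ∀ S : Finset (ℤ × ℤ), (∀ ℓ ∈ S, ((ℓ.1 : ℝ)) ^ 2 + ((ℓ.2 : ℝ)) ^ 2 = lam ^ 2) →
      ∀ a : ℤ × ℤ → ℂ, ∀ x₀ v : ℝ × ℝ, v.1 ^ 2 + v.2 ^ 2 = 1 →
        (∫ t in (0 : ℝ)..1,
            ‖∑ ℓ ∈ S, a ℓ *
              Complex.exp ((((x₀.1 + t * v.1) * ℓ.1 + (x₀.2 + t * v.2) * ℓ.2 : ℝ) : ℂ) *
                Complex.I)‖ ^ 2)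
          ≤ Cε * lam ^ ε *
            ∫ x in (Set.Icc (0 : ℝ) (2 * π)) ×ˢ (Set.Icc (0 : ℝ) (2 * π)),
              ‖∑ ℓ ∈ S, a ℓ *
                Complex.exp (((x.1 * ℓ.1 + x.2 * ℓ.2 : ℝ) : ℂ) * Complex.I)‖ ^ 2 := by
  intro ε hε
  obtain ⟨C, hC, hcard⟩ := exists_card_latticePoints_circle_le hε
  refine ⟨C, hC, fun lam hlam S hS a x₀ v _ => ?_⟩
  rw [setIntegral_norm_sq_trigPoly]
  have hpt : ∀ θ : ℤ × ℤ → ℝ, ‖∑ ℓ ∈ S, a ℓ * Complex.exp ((θ ℓ : ℂ) * Complex.I)‖ ^ 2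
      ≤ S.card * ∑ ℓ ∈ S, ‖a ℓ‖ ^ 2 := fun θ =>
    calc ‖∑ ℓ ∈ S, a ℓ * Complex.exp ((θ ℓ : ℂ) * Complex.I)‖ ^ 2
        ≤ (∑ ℓ ∈ S, ‖a ℓ‖) ^ 2 := by
          gcongr
          refine (norm_sum_le _ _).trans_eq (Finset.sum_congr rfl fun ℓ _ => ?_)
          rw [norm_mul, Complex.norm_exp_ofReal_mul_I, mul_one]
      _ ≤ _ := sq_sum_le_card_mul_sum_sq
  have hle := intervalIntegral.norm_integral_le_of_norm_le_const (a := (0 : ℝ)) (b := 1)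
    (f := fun t : ℝ => ‖∑ ℓ ∈ S, a ℓ *
      Complex.exp ((((x₀.1 + t * v.1) * ℓ.1 + (x₀.2 + t * v.2) * ℓ.2 : ℝ) : ℂ) *
        Complex.I)‖ ^ 2) (C := S.card * ∑ ℓ ∈ S, ‖a ℓ‖ ^ 2) fun t _ => by
      rw [Real.norm_of_nonneg (by positivity)]
      exact hpt _
  rw [sub_zero, abs_one, mul_one] at hle
  have hsum : 0 ≤ ∑ ℓ ∈ S, ‖a ℓ‖ ^ 2 := by positivity
  have hpi : 1 ≤ (2 * π) ^ 2 := one_le_pow₀ (by linarith [Real.two_le_pi])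
  calc _ ≤ (S.card : ℝ) * ∑ ℓ ∈ S, ‖a ℓ‖ ^ 2 := (le_abs_self _).trans hle
    _ ≤ C * lam ^ ε * ∑ ℓ ∈ S, ‖a ℓ‖ ^ 2 := by
        gcongr
        exact hcard lam hlam S hS
    _ ≤ C * lam ^ ε * ((2 * π) ^ 2 * ∑ ℓ ∈ S, ‖a ℓ‖ ^ 2) := by
        gcongr
        exact le_mul_of_one_le_left hsum hpi

end
end

section
/- For every ε > 0 there is a constant C_ε such that for every λ ≥ 1, every toral eigenfunction f with eigenvalue λ² (i.e. f(x) = Σ_{ℓ ∈ ℤ², |ℓ| = λ} a_ℓ e^{i⟨x,ℓ⟩} with complex coefficients a_ℓ), every x₀ ∈ ℝ² and every unit vector v ∈ ℝ², one has ∫_{T} |f(x)|² dx ≤ C_ε λ^{−1/2 + ε} ∫_{[0,2π]²} |f(x)|² dx, where T = { x ∈ ℝ² : dist(x, γ) ≤ λ^{−1/2} } is the tube of width λ^{−1/2} around the unit segment γ = { x₀ + t v : t ∈ [0,1] }. -/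
open MeasureTheory Real

noncomputable section

theorem add_one_le_const_mul_rpow_pow {δ : ℝ} (hδ : 0 < δ) {w : ℝ} (hw : 2 ≤ w) (e : ℕ) :
    (e + 1 : ℝ) ≤ (1 + 1 / (δ * log 2)) * (w ^ δ) ^ e := by
  have hl : 0 < δ * log 2 := mul_pos hδ (log_pos one_lt_two)
  have h1 : 1 + δ * log 2 ≤ w ^ δ := by
    calc 1 + δ * log 2 ≤ exp (δ * log 2) := by linarith [add_one_le_exp (δ * log 2)]
      _ = 2 ^ δ := by rw [rpow_def_of_pos two_pos, mul_comm]
      _ ≤ w ^ δ := rpow_le_rpow two_pos.le hw hδ.le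
  have h2 : 1 + e * (δ * log 2) ≤ (w ^ δ) ^ e :=
    (one_add_mul_le_pow (by linarith) e).trans (pow_le_pow_left₀ (by linarith) h1 e)
  calc (e + 1 : ℝ) ≤ (1 + 1 / (δ * log 2)) * (1 + e * (δ * log 2)) := by
        have : (1 + 1 / (δ * log 2)) * (1 + e * (δ * log 2))
            = (e + 1) + (1 / (δ * log 2) + e * (δ * log 2)) := by field_simp; ring
        rw [this]
        have : 0 ≤ 1 / (δ * log 2) + e * (δ * log 2) := by positivity
        linarith
    _ ≤ _ := by gcongr

/-- A divisor bound for multisets of weighted elements, only boundedly many of which are small. -/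
theorem card_Iic_multiset_le {α : Type*} [DecidableEq α] {δ : ℝ} (hδ : 0 < δ) (w : α → ℝ)
    (P : Finset α) (M : Multiset α) (hM : ∀ p ∈ M, 2 ≤ w p)
    (hP : ∀ p ∈ M, p ∉ P → 2 ≤ w p ^ δ) :
    ((Finset.Iic M).card : ℝ) ≤
      (1 + 1 / (δ * log 2)) ^ P.card * (M.map fun p ↦ w p ^ δ).prod := by
  set K : ℝ := 1 + 1 / (δ * log 2)
  have hl : 0 < δ * log 2 := mul_pos hδ (log_pos one_lt_two)
  have hK : 1 ≤ K := le_add_of_nonneg_right (by positivity)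
  rw [Multiset.card_Iic, Finset.prod_multiset_map_count]
  push_cast
  calc ∏ p ∈ M.toFinset, ((M.count p : ℝ) + 1)
      ≤ ∏ p ∈ M.toFinset, ((if p ∈ P then K else 1) * (w p ^ δ) ^ M.count p) := by
        refine Finset.prod_le_prod (fun _ _ ↦ by positivity) fun p hp ↦ ?_
        have hp := Multiset.mem_toFinset.1 hp
        split_ifs with h
        · exact add_one_le_const_mul_rpow_pow hδ (hM p hp) _
        · rw [one_mul]
          calc ((M.count p : ℝ) + 1) = 1 + M.count p * 1 := by ring
            _ ≤ (1 + 1) ^ M.count p := one_add_mul_le_pow (by norm_num) _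
            _ ≤ _ := pow_le_pow_left₀ (by norm_num) (by linarith [hP p hp h]) _
    _ = K ^ (M.toFinset.filter (· ∈ P)).card * ∏ p ∈ M.toFinset, (w p ^ δ) ^ M.count p := by
        rw [Finset.prod_mul_distrib, Finset.prod_ite, Finset.prod_const, Finset.prod_const_one,
          mul_one]
    _ ≤ _ := by
        gcongr
        · exact Finset.prod_nonneg fun p hp ↦
            pow_nonneg (rpow_nonneg (by linarith [hM p (Multiset.mem_toFinset.1 hp)]) _) _
        · exact fun p hp ↦ (Finset.mem_filter.1 hp).2

namespace GaussianInt

theorem norm_eq_sq_add_sq_s9 (z : GaussianInt) : z.norm = z.re ^ 2 + z.im ^ 2 := by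
  rw [Zsqrtd.norm_def]; ring

theorem two_le_norm {z : GaussianInt} (h0 : z ≠ 0) (h1 : ¬ IsUnit z) : 2 ≤ z.norm := by
  have h : 0 < z.norm := GaussianInt.norm_pos.2 h0
  have h' : z.norm ≠ 1 := fun h ↦ h1 (Zsqrtd.norm_eq_one_iff.1 (by rw [h]; rfl))
  omega

/-- The Gaussian integers with both coordinates in `[-b, b]`. -/
def box (b : ℤ) : Finset GaussianInt :=
  (Finset.Icc (-b) b ×ˢ Finset.Icc (-b) b).image fun p ↦ ⟨p.1, p.2⟩

theorem mem_box_of_norm_le {z : GaussianInt} {b : ℤ} (hz : z.norm ≤ b) : z ∈ box b := by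
  rw [norm_eq_sq_add_sq_s9] at hz
  refine Finset.mem_image.2 ⟨(z.re, z.im), ?_, rfl⟩
  simp only [Finset.mem_product, Finset.mem_Icc]
  refine ⟨⟨?_, ?_⟩, ?_, ?_⟩ <;>
    nlinarith [sq_nonneg (z.re - 1), sq_nonneg (z.im - 1), sq_nonneg (z.re + 1),
      sq_nonneg (z.im + 1), Int.le_self_sq z.re, Int.le_self_sq z.im, Int.le_self_sq (-z.re),
      Int.le_self_sq (-z.im), sq_nonneg z.re, sq_nonneg z.im]

theorem card_associated_le (T : Finset GaussianInt)
    (hT : ∀ z ∈ T, ∀ w ∈ T, Associated z w) : T.card ≤ (box 1).card := by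
  classical
  rcases T.eq_empty_or_nonempty with rfl | ⟨z, hz⟩
  · simp
  refine (Finset.card_le_card fun w hw ↦ ?_).trans
    (Finset.card_image_le (s := box 1) (f := fun u ↦ z * u))
  obtain ⟨u, rfl⟩ := hT z hz w hw
  refine Finset.mem_image.2 ⟨u, mem_box_of_norm_le ?_, rfl⟩
  have := Zsqrtd.norm_eq_one_iff.2 u.isUnit
  have h0 := GaussianInt.norm_nonneg (u : GaussianInt)
  omega

/-- The norm as a monoid homomorphism to the reals. -/
def realNorm : GaussianInt →* ℝ :=
  (Int.castRingHom ℝ : ℤ →* ℝ).comp Zsqrtd.normMonoidHom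

theorem realNorm_apply (z : GaussianInt) : realNorm z = (z.norm : ℝ) := rfl

open UniqueFactorizationMonoid in
/-- The number of Gaussian integers of norm `n` is `O(n ^ η)` for every `η > 0`. -/
theorem card_norm_eq_le {η : ℝ} (hη : 0 < η) :
    ∃ C : ℝ, 0 < C ∧ ∀ n : ℤ, 0 < n → ∀ T : Finset GaussianInt,
      (∀ z ∈ T, z.norm = n) → (T.card : ℝ) ≤ C * (n : ℝ) ^ η := by
  classical
  let _ : StrongNormalizationMonoid GaussianInt :=
    UniqueFactorizationMonoid.strongNormalizationMonoid
  set δ := η / 2 with hδη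
  have hδ : 0 < δ := half_pos hη
  set P := box ⌈(2 : ℝ) ^ (1 / δ)⌉ with hPdef
  set K : ℝ := 1 + 1 / (δ * log 2)
  have hl : 0 < δ * log 2 := mul_pos hδ (log_pos one_lt_two)
  have hK : 0 < K := by positivity
  refine ⟨(box 1).card * K ^ P.card, ?_, fun n hn T hT ↦ ?_⟩
  · have : 0 < (box 1).card := Finset.card_pos.2 ⟨0, mem_box_of_norm_le (by simp)⟩
    positivity
  have hn0 : (n : GaussianInt) ≠ 0 := by exact_mod_cast hn.ne'
  have hT0 : ∀ z ∈ T, z ≠ 0 := fun z hz ↦ GaussianInt.norm_pos.1 (by rw [hT z hz]; exact hn)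
  set M := normalizedFactors (n : GaussianInt)
  have hmaps : ∀ z ∈ T, normalizedFactors z ∈ Finset.Iic M := fun z hz ↦ by
    rw [Finset.mem_Iic, ← dvd_iff_normalizedFactors_le_normalizedFactors (hT0 z hz) hn0]
    exact ⟨star z, by rw [← Zsqrtd.norm_eq_mul_conj, hT z hz]⟩
  have hcard : T.card ≤ (box 1).card * (Finset.Iic M).card := by
    refine Finset.card_le_mul_card_image_of_maps_to hmaps _ fun m _ ↦ card_associated_le _ ?_
    intro z hz w hw
    rw [Finset.mem_filter] at hz hw
    rw [associated_iff_normalizedFactors_eq_normalizedFactors (hT0 z hz.1) (hT0 w hw.1),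
      hz.2, hw.2]
  have hM : ∀ p ∈ M, 2 ≤ realNorm p := fun p hp ↦ by
    have hp := irreducible_of_normalized_factor p hp
    rw [realNorm_apply]
    exact_mod_cast two_le_norm hp.ne_zero hp.not_isUnit
  have hP : ∀ p ∈ M, p ∉ P → 2 ≤ realNorm p ^ δ := fun p hp hpP ↦ by
    have h : (2 : ℝ) ^ (1 / δ) ≤ realNorm p := by
      refine (Int.le_ceil _).trans ?_
      rw [realNorm_apply]
      exact_mod_cast (le_of_not_ge fun h ↦ hpP (mem_box_of_norm_le h))
    calc (2 : ℝ) = (2 ^ (1 / δ)) ^ δ := by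
          rw [← rpow_mul two_pos.le, one_div_mul_cancel hδ.ne', rpow_one]
      _ ≤ _ := rpow_le_rpow (by positivity) h hδ.le
  have hprod : (M.map fun p ↦ realNorm p ^ δ).prod = (n : ℝ) ^ η := by
    have hnn : ∀ p ∈ M, 0 ≤ realNorm p := fun p hp ↦ by linarith [hM p hp]
    rw [Real.multiset_prod_map_rpow _ _ hnn, Multiset.prod_hom]
    have : realNorm M.prod = (n : ℝ) ^ (2 : ℝ) := by
      have h := Zsqrtd.norm_eq_of_associated (by norm_num) (prod_normalizedFactors hn0)
      rw [realNorm_apply, h, Zsqrtd.norm_intCast]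
      push_cast
      rw [rpow_two]; ring
    rw [this, ← rpow_mul (by exact_mod_cast hn.le)]
    congr 1
    rw [hδη]; ring
  calc (T.card : ℝ) ≤ (box 1).card * (Finset.Iic M).card := by exact_mod_cast hcard
    _ ≤ (box 1).card * (K ^ P.card * (n : ℝ) ^ η) := by
      gcongr
      rw [← hprod]
      exact card_Iic_multiset_le hδ _ P M hM hP
    _ = _ := by ring

end GaussianInt
/-- The number of lattice points on a circle of radius `√r` is `O(r ^ η)` for every `η > 0`. -/
theorem card_sq_add_sq_eq_le {η : ℝ} (hη : 0 < η) :
    ∃ C : ℝ, 0 < C ∧ ∀ r : ℝ, 0 < r → ∀ S : Finset (ℤ × ℤ),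
      (∀ ℓ ∈ S, (ℓ.1 : ℝ) ^ 2 + (ℓ.2 : ℝ) ^ 2 = r) → (S.card : ℝ) ≤ C * r ^ η := by
  classical
  obtain ⟨C, hC, h⟩ := GaussianInt.card_norm_eq_le hη
  refine ⟨C, hC, fun r hr S hS ↦ ?_⟩
  rcases S.eq_empty_or_nonempty with rfl | ⟨ℓ₀, hℓ₀⟩
  · simp only [Finset.card_empty, Nat.cast_zero]
    positivity
  have hinj : Function.Injective fun ℓ : ℤ × ℤ ↦ (⟨ℓ.1, ℓ.2⟩ : GaussianInt) := fun ℓ m hℓm ↦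
    Prod.ext (congrArg Zsqrtd.re hℓm) (congrArg Zsqrtd.im hℓm)
  obtain ⟨n, rfl⟩ : ∃ n : ℤ, (n : ℝ) = r := ⟨ℓ₀.1 ^ 2 + ℓ₀.2 ^ 2, by
    rw [← hS ℓ₀ hℓ₀]; push_cast; rfl⟩
  rw [← Finset.card_image_of_injective S hinj]
  refine h n (by exact_mod_cast hr) _ fun z hz ↦ ?_
  obtain ⟨ℓ, hℓ, rfl⟩ := Finset.mem_image.1 hz
  rw [GaussianInt.norm_eq_sq_add_sq_s9]
  exact_mod_cast hS ℓ hℓ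

/-- The linear map carrying the standard basis of the plane to `v` and its rotation by `π / 2`. -/
def frameMap (v : ℝ × ℝ) : ℝ × ℝ →ₗ[ℝ] ℝ × ℝ :=
  Matrix.toLin (Module.Basis.finTwoProd ℝ) (Module.Basis.finTwoProd ℝ) !![v.1, -v.2; v.2, v.1]

theorem frameMap_apply (v p : ℝ × ℝ) :
    frameMap v p = (v.1 * p.1 - v.2 * p.2, v.2 * p.1 + v.1 * p.2) := by
  rw [frameMap, Matrix.toLin_finTwoProd_apply]
  simp [sub_eq_add_neg]

theorem det_frameMap (v : ℝ × ℝ) : LinearMap.det (frameMap v) = v.1 ^ 2 + v.2 ^ 2 := by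
  rw [frameMap, LinearMap.det_toLin, Matrix.det_fin_two_of]; ring

/-- The closed `δ`-neighbourhood of the segment from `x₀` to `x₀ + v`. -/
def segmentTube (x₀ v : ℝ × ℝ) (δ : ℝ) : Set (ℝ × ℝ) :=
  {x | ∃ t ∈ Set.Icc (0 : ℝ) 1,
    √((x.1 - (x₀.1 + t * v.1)) ^ 2 + (x.2 - (x₀.2 + t * v.2)) ^ 2) ≤ δ}

theorem segmentTube_subset {v : ℝ × ℝ} (hv : v.1 ^ 2 + v.2 ^ 2 = 1) (x₀ : ℝ × ℝ) {δ : ℝ}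
    (hδ : 0 ≤ δ) :
    segmentTube x₀ v δ ⊆
      (x₀ + ·) '' (frameMap v '' (Set.Icc (-δ) (1 + δ) ×ˢ Set.Icc (-δ) δ)) := by
  rintro x ⟨t, ⟨ht0, ht1⟩, hx⟩
  rw [Real.sqrt_le_left hδ] at hx
  set p := x.1 - (x₀.1 + t * v.1) with hp
  set q := x.2 - (x₀.2 + t * v.2) with hq
  have hsum : (v.1 * p + v.2 * q) ^ 2 + (v.1 * q - v.2 * p) ^ 2 ≤ δ ^ 2 := by
    calc _ = (v.1 ^ 2 + v.2 ^ 2) * (p ^ 2 + q ^ 2) := by ring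
      _ ≤ _ := by rw [hv, one_mul]; exact hx
  have h1 := abs_le.1 (abs_le_of_sq_le_sq
    (by nlinarith [sq_nonneg (v.1 * q - v.2 * p)] : (v.1 * p + v.2 * q) ^ 2 ≤ δ ^ 2) hδ)
  have h2 := abs_le.1 (abs_le_of_sq_le_sq
    (by nlinarith [sq_nonneg (v.1 * p + v.2 * q)] : (v.1 * q - v.2 * p) ^ 2 ≤ δ ^ 2) hδ)
  refine ⟨_, ⟨(t + (v.1 * p + v.2 * q), v.1 * q - v.2 * p),
    ⟨⟨by dsimp only; linarith, by dsimp only; linarith⟩, h2⟩, rfl⟩, ?_⟩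
  rw [frameMap_apply]
  ext
  · simp only [Prod.fst_add]
    linear_combination hp + p * hv
  · simp only [Prod.snd_add]
    linear_combination hq + q * hv

theorem volume_segmentTube_le {v : ℝ × ℝ} (hv : v.1 ^ 2 + v.2 ^ 2 = 1) (x₀ : ℝ × ℝ) {δ : ℝ}
    (hδ : 0 ≤ δ) :
    volume (segmentTube x₀ v δ) ≤ ENNReal.ofReal ((1 + 2 * δ) * (2 * δ)) := by
  refine (measure_mono (segmentTube_subset hv x₀ hδ)).trans_eq ?_
  rw [Set.image_add_left, measure_preimage_add, Measure.addHaar_image_linearMap, det_frameMap, hv,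
    Measure.volume_eq_prod, Measure.prod_prod, Real.volume_Icc, Real.volume_Icc,
    ← ENNReal.ofReal_mul (by linarith)]
  simp only [abs_one, ENNReal.ofReal_one, one_mul]
  congr 1; ring

theorem integral_Icc_exp_int (k : ℤ) :
    ∫ x in Set.Icc (0 : ℝ) (2 * π), Complex.exp (((x * k : ℝ) : ℂ) * Complex.I) =
      if k = 0 then 2 * (π : ℂ) else 0 := by
  rw [integral_Icc_eq_integral_Ioc, ← intervalIntegral.integral_of_le two_pi_pos.le]
  split_ifs with hk
  · simp [hk]
  · have hc : (k : ℂ) * Complex.I ≠ 0 := mul_ne_zero (by exact_mod_cast hk) Complex.I_ne_zero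
    have : ∀ x : ℝ, ((x * k : ℝ) : ℂ) * Complex.I = (k : ℂ) * Complex.I * x := fun x ↦ by
      push_cast; ring
    simp_rw [this]
    rw [integral_exp_mul_complex hc, Complex.ofReal_zero, mul_zero, Complex.exp_zero]
    have : (k : ℂ) * Complex.I * ((2 * π : ℝ) : ℂ) = k * (2 * π * Complex.I) := by push_cast; ring
    rw [this, Complex.exp_int_mul_two_pi_mul_I, sub_self, zero_div]

/-- The trigonometric polynomial with coefficients `a` on the frequencies `S`. -/
def trigPoly (S : Finset (ℤ × ℤ)) (a : ℤ × ℤ → ℂ) (x : ℝ × ℝ) : ℂ :=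
  ∑ ℓ ∈ S, a ℓ * Complex.exp (((x.1 * ℓ.1 + x.2 * ℓ.2 : ℝ) : ℂ) * Complex.I)

theorem integral_exp_sub (ℓ m : ℤ × ℤ) :
    ∫ x in (Set.Icc (0 : ℝ) (2 * π)) ×ˢ (Set.Icc (0 : ℝ) (2 * π)),
      Complex.exp (((x.1 * ℓ.1 + x.2 * ℓ.2 : ℝ) : ℂ) * Complex.I) *
        (starRingEnd ℂ) (Complex.exp (((x.1 * m.1 + x.2 * m.2 : ℝ) : ℂ) * Complex.I)) =
      if ℓ = m then (2 * (π : ℂ)) ^ 2 else 0 := by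
  have (x : ℝ × ℝ) : Complex.exp (((x.1 * ℓ.1 + x.2 * ℓ.2 : ℝ) : ℂ) * Complex.I) *
        (starRingEnd ℂ) (Complex.exp (((x.1 * m.1 + x.2 * m.2 : ℝ) : ℂ) * Complex.I)) =
      Complex.exp (((x.1 * (ℓ.1 - m.1 : ℤ) : ℝ) : ℂ) * Complex.I) *
        Complex.exp (((x.2 * (ℓ.2 - m.2 : ℤ) : ℝ) : ℂ) * Complex.I) := by
    rw [← Complex.exp_conj, ← Complex.exp_add, ← Complex.exp_add, map_mul, Complex.conj_ofReal,
      Complex.conj_I]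
    congr 1
    push_cast
    ring
  simp_rw [this]
  rw [Measure.volume_eq_prod, setIntegral_prod_mul
    (fun x : ℝ ↦ Complex.exp (((x * (ℓ.1 - m.1 : ℤ) : ℝ) : ℂ) * Complex.I))
    (fun x : ℝ ↦ Complex.exp (((x * (ℓ.2 - m.2 : ℤ) : ℝ) : ℂ) * Complex.I)),
    integral_Icc_exp_int, integral_Icc_exp_int]
  simp only [sub_eq_zero, Prod.ext_iff]
  by_cases h1 : ℓ.1 = m.1 <;> by_cases h2 : ℓ.2 = m.2 <;> simp [h1, h2, sq]

theorem integral_norm_sq_trigPoly (S : Finset (ℤ × ℤ)) (a : ℤ × ℤ → ℂ) :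
    ∫ x in (Set.Icc (0 : ℝ) (2 * π)) ×ˢ (Set.Icc (0 : ℝ) (2 * π)), ‖trigPoly S a x‖ ^ 2 =
      (2 * π) ^ 2 * ∑ ℓ ∈ S, ‖a ℓ‖ ^ 2 := by
  have hexp (x : ℝ × ℝ) : ((‖trigPoly S a x‖ ^ 2 : ℝ) : ℂ) =
      ∑ ℓ ∈ S, ∑ m ∈ S, a ℓ * (starRingEnd ℂ) (a m) *
        (Complex.exp (((x.1 * ℓ.1 + x.2 * ℓ.2 : ℝ) : ℂ) * Complex.I) *
        (starRingEnd ℂ) (Complex.exp (((x.1 * m.1 + x.2 * m.2 : ℝ) : ℂ) * Complex.I))) := by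
    rw [Complex.ofReal_pow, ← Complex.mul_conj', trigPoly, map_sum, Finset.sum_mul_sum]
    refine Finset.sum_congr rfl fun ℓ _ ↦ Finset.sum_congr rfl fun m _ ↦ ?_
    rw [map_mul]
    ring
  have hint (ℓ m : ℤ × ℤ) : IntegrableOn (fun x : ℝ × ℝ ↦ a ℓ * (starRingEnd ℂ) (a m) *
        (Complex.exp (((x.1 * ℓ.1 + x.2 * ℓ.2 : ℝ) : ℂ) * Complex.I) *
        (starRingEnd ℂ) (Complex.exp (((x.1 * m.1 + x.2 * m.2 : ℝ) : ℂ) * Complex.I))))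
      ((Set.Icc (0 : ℝ) (2 * π)) ×ˢ (Set.Icc (0 : ℝ) (2 * π))) := by
    refine ContinuousOn.integrableOn_compact (isCompact_Icc.prod isCompact_Icc)
      (Continuous.continuousOn ?_)
    have := Complex.continuous_conj
    fun_prop
  rw [← Complex.ofReal_inj, ← integral_complex_ofReal]
  simp_rw [hexp]
  rw [integral_finsetSum _ fun ℓ _ ↦ integrable_finsetSum _ fun m _ ↦ hint ℓ m]
  rw [Finset.mul_sum, Complex.ofReal_sum]
  refine Finset.sum_congr rfl fun ℓ hℓ ↦ ?_
  rw [integral_finsetSum _ fun m _ ↦ hint ℓ m]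
  simp_rw [integral_const_mul, integral_exp_sub]
  simp only [mul_ite, mul_zero, Finset.sum_ite_eq, hℓ, if_true]
  rw [Complex.mul_conj', mul_comm]
  push_cast
  rfl

theorem norm_sq_trigPoly_le (S : Finset (ℤ × ℤ)) (a : ℤ × ℤ → ℂ) (x : ℝ × ℝ) :
    ‖trigPoly S a x‖ ^ 2 ≤ S.card * ∑ ℓ ∈ S, ‖a ℓ‖ ^ 2 := by
  refine (pow_le_pow_left₀ (norm_nonneg _) ?_ 2).trans
    (sq_sum_le_card_mul_sum_sq (s := S) (f := fun ℓ ↦ ‖a ℓ‖))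
  refine (norm_sum_le _ _).trans_eq (Finset.sum_congr rfl fun ℓ _ ↦ ?_)
  rw [norm_mul, Complex.norm_exp_ofReal_mul_I, mul_one]

/-- Trivial bound: sup norm times area. -/
theorem setIntegral_segmentTube_le {v : ℝ × ℝ} (hv : v.1 ^ 2 + v.2 ^ 2 = 1) (x₀ : ℝ × ℝ) {δ : ℝ}
    (hδ : 0 ≤ δ) (hδ1 : δ ≤ 1) (S : Finset (ℤ × ℤ)) (a : ℤ × ℤ → ℂ) :
    ∫ x in segmentTube x₀ v δ, ‖trigPoly S a x‖ ^ 2 ≤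
      S.card * (∑ ℓ ∈ S, ‖a ℓ‖ ^ 2) * (6 * δ) := by
  have hvol := volume_segmentTube_le hv x₀ hδ
  have hA : 0 ≤ S.card * ∑ ℓ ∈ S, ‖a ℓ‖ ^ 2 := by positivity
  refine (Real.le_norm_self _).trans ((norm_setIntegral_le_of_norm_le_const
    (hvol.trans_lt ENNReal.ofReal_lt_top) (C := S.card * ∑ ℓ ∈ S, ‖a ℓ‖ ^ 2)
    fun x _ ↦ ?_).trans ?_)
  · rw [Real.norm_of_nonneg (by positivity)]
    exact norm_sq_trigPoly_le S a x
  · refine mul_le_mul_of_nonneg_left ?_ hA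
    refine (ENNReal.toReal_le_of_le_ofReal (by positivity) hvol).trans ?_
    nlinarith

/-- Kakeya–Nikodym tube bound for toral eigenfunctions: for every `ε > 0` there is `C_ε`
such that for every eigenfunction `f(x) = Σ_{ℓ ∈ ℤ², |ℓ| = λ} a_ℓ e^{i⟨x,ℓ⟩}` with `λ ≥ 1`
and every tube `T` of width `λ^{-1/2}` around a unit segment `γ = {x₀ + t v : t ∈ [0,1]}`,
`∫_T |f|² ≤ C_ε λ^{-1/2+ε} ∫_{[0,2π]²} |f|²`. -/
theorem toral_tube_bound :
    ∀ ε : ℝ, 0 < ε → ∃ Cε : ℝ, 0 < Cε ∧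
      ∀ lam : ℝ, 1 ≤ lam →
      ∀ S : Finset (ℤ × ℤ), (∀ ℓ ∈ S, ((ℓ.1 : ℝ)) ^ 2 + ((ℓ.2 : ℝ)) ^ 2 = lam ^ 2) →
      ∀ a : ℤ × ℤ → ℂ, ∀ x₀ v : ℝ × ℝ, v.1 ^ 2 + v.2 ^ 2 = 1 →
        (∫ x in {x : ℝ × ℝ | ∃ t ∈ Set.Icc (0 : ℝ) 1,
              Real.sqrt ((x.1 - (x₀.1 + t * v.1)) ^ 2 + (x.2 - (x₀.2 + t * v.2)) ^ 2) ≤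
                lam ^ (-(1 / 2) : ℝ)},
            ‖∑ ℓ ∈ S, a ℓ *
              Complex.exp (((x.1 * ℓ.1 + x.2 * ℓ.2 : ℝ) : ℂ) * Complex.I)‖ ^ 2)
          ≤ Cε * lam ^ (-(1 / 2 : ℝ) + ε) *
            ∫ x in (Set.Icc (0 : ℝ) (2 * π)) ×ˢ (Set.Icc (0 : ℝ) (2 * π)),
              ‖∑ ℓ ∈ S, a ℓ *
                Complex.exp (((x.1 * ℓ.1 + x.2 * ℓ.2 : ℝ) : ℂ) * Complex.I)‖ ^ 2 := by
  intro ε hε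
  obtain ⟨C, hC, hcard⟩ := card_sq_add_sq_eq_le (half_pos hε)
  refine ⟨6 * C / (2 * π) ^ 2, by positivity, fun lam hlam S hS a x₀ v hv ↦ ?_⟩
  have hlam0 : 0 < lam := by linarith
  have hδ1 : lam ^ (-(1 / 2) : ℝ) ≤ 1 := rpow_le_one_of_one_le_of_nonpos hlam (by norm_num)
  have hS' : (S.card : ℝ) ≤ C * lam ^ ε := by
    refine (hcard (lam ^ 2) (by positivity) S hS).trans_eq ?_
    rw [← rpow_natCast, ← rpow_mul hlam0.le]
    congr 2
    push_cast
    ring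
  change ∫ x in segmentTube x₀ v (lam ^ (-(1 / 2) : ℝ)), ‖trigPoly S a x‖ ^ 2 ≤ _ *
    ∫ x in (Set.Icc (0 : ℝ) (2 * π)) ×ˢ (Set.Icc (0 : ℝ) (2 * π)), ‖trigPoly S a x‖ ^ 2
  rw [integral_norm_sq_trigPoly]
  refine (setIntegral_segmentTube_le hv x₀ (by positivity) hδ1 S a).trans ?_
  calc S.card * (∑ ℓ ∈ S, ‖a ℓ‖ ^ 2) * (6 * lam ^ (-(1 / 2) : ℝ))
      ≤ C * lam ^ ε * (∑ ℓ ∈ S, ‖a ℓ‖ ^ 2) * (6 * lam ^ (-(1 / 2) : ℝ)) := by gcongr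
    _ = _ := by
      rw [rpow_add hlam0]
      field_simp

end
end

section
/- For every δ > 0 there is a constant k(δ) such that for every R ≥ 1 and every arc Γ of the circle { x ∈ ℝ² : |x| = R } of arclength at most R^{1/2 − δ} (equivalently, of angular aperture at most R^{−1/2 − δ}), the number of lattice points of ℤ² lying on Γ is at most k(δ). -/
open Real

noncomputable section

open Matrix in
/-- Distinct Gaussian integers on a common circle satisfy a lower bound for their Vandermonde
determinant: it differs by a power of the radius from the determinant of the matrix of powers
`z, …, z ^ k`, `1`, `star z, …, star z ^ k`, which is a nonzero Gaussian integer. -/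
theorem GaussianInt.norm_pow_sq_le_prod_norm_sub {k : ℕ} {n : ℤ} (hn : 0 < n)
    (z : Fin (2 * k + 1) → GaussianInt) (hz : Function.Injective z) (hzn : ∀ i, (z i).norm = n) :
    n ^ (k ^ 2) ≤ ∏ i, ∏ j ∈ Finset.Ioi i, (z j - z i).norm := by
  let M : Matrix (Fin (2 * k + 1)) (Fin (2 * k + 1)) GaussianInt :=
    Matrix.of fun i j ↦ star (z i) ^ (k - (j : ℕ)) * z i ^ ((j : ℕ) - k)
  have hM : diagonal (fun i ↦ z i ^ k) * M =
      vandermonde z * diagonal (fun j : Fin (2 * k + 1) ↦ (n : GaussianInt) ^ (k - (j : ℕ))) := by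
    ext1 i j
    rw [diagonal_mul, mul_diagonal, vandermonde_apply]
    have hconj : (n : GaussianInt) = z i * star (z i) := by
      rw [← Zsqrtd.norm_eq_mul_conj, hzn]
    rw [hconj, mul_pow]
    simp only [M, Matrix.of_apply]
    rcases le_total k (j : ℕ) with h | h
    · obtain ⟨d, hd⟩ := Nat.exists_eq_add_of_le h
      simp [hd, pow_add]
    · rw [Nat.sub_eq_zero_of_le h, pow_zero, mul_one, ← mul_assoc, ← pow_add,
        Nat.add_sub_cancel' h]
  have hsum : ∑ j : Fin (2 * k + 1), (k - (j : ℕ)) * 2 = k ^ 2 + k := by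
    rw [Fin.sum_univ_eq_sum_range (fun j ↦ (k - j) * 2),
      show 2 * k + 1 = (k + 1) + k by ring, Finset.sum_range_add]
    have h0 : ∑ x ∈ Finset.range k, (k - (k + 1 + x)) * 2 = 0 :=
      Finset.sum_eq_zero fun x _ ↦ by rw [Nat.sub_eq_zero_of_le (by omega), zero_mul]
    rw [h0, add_zero, ← Finset.sum_mul]
    have := Finset.sum_range_reflect (fun j ↦ j) (k + 1)
    simp only [Nat.add_sub_cancel] at this
    rw [this, Finset.sum_range_id_mul_two, Nat.add_sub_cancel]
    ring
  have hnorm : n ^ (k ^ 2) * (vandermonde z).det.norm * n ^ k =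
      n ^ (k ^ 2) * n ^ (k ^ 2) * M.det.norm * n ^ k := by
    have h := congrArg (fun A ↦ Zsqrtd.normMonoidHom A.det) hM
    simp only [det_mul, det_diagonal, map_mul, map_prod, map_pow] at h
    simp only [Zsqrtd.normMonoidHom, MonoidHom.coe_mk, OneHom.coe_mk, hzn,
      Zsqrtd.norm_intCast, ← pow_two, ← pow_mul, mul_comm 2, Finset.prod_pow_eq_pow_sum, hsum,
      Finset.sum_const, Finset.card_univ, Fintype.card_fin, smul_eq_mul] at h
    calc _ = (vandermonde z).det.norm * n ^ (k ^ 2 + k) := by ring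
      _ = _ := by rw [← h]; ring
  have hV : (vandermonde z).det.norm = n ^ (k ^ 2) * M.det.norm := by
    have h1 := mul_right_cancel₀ (pow_pos hn k).ne' hnorm
    rw [mul_assoc] at h1
    exact mul_left_cancel₀ (pow_pos hn _).ne' h1
  have hM0 : 0 < M.det.norm := by
    refine lt_of_le_of_ne (GaussianInt.norm_nonneg _) fun h0 ↦ ?_
    rw [← h0, mul_zero, GaussianInt.norm_eq_zero] at hV
    exact det_vandermonde_ne_zero_iff.mpr hz hV
  calc n ^ (k ^ 2) ≤ n ^ (k ^ 2) * M.det.norm := le_mul_of_one_le_right (pow_pos hn _).le hM0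
    _ = ∏ i, ∏ j ∈ Finset.Ioi i, (z j - z i).norm := by
      rw [← hV, det_vandermonde]
      change Zsqrtd.normMonoidHom _ = _
      simp only [map_prod]
      rfl

/-- The square of a chord of a circle is smaller than that of the arc it subtends. -/
theorem Real.sq_chord_lt_sq_arc {R s t : ℝ} (hR : R ≠ 0) (hst : s ≠ t) :
    (R * cos t - R * cos s) ^ 2 + (R * sin t - R * sin s) ^ 2 < R ^ 2 * (t - s) ^ 2 := by
  have h := Real.one_sub_sq_div_two_lt_cos (sub_ne_zero.mpr hst.symm)
  rw [Real.cos_sub] at h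
  have hR2 : 0 < R ^ 2 := by positivity
  calc _ = R ^ 2 * (2 - 2 * (cos t * cos s + sin t * sin s)) := by
        linear_combination R ^ 2 * (sin_sq_add_cos_sq t + sin_sq_add_cos_sq s)
    _ < _ := by gcongr; linarith

/-- An arc of a circle of radius `R` containing `2 * k + 1` lattice points has length greater than
`R ^ (k / (2 * k + 1))`. -/
theorem lt_pow_of_lattice_points_on_arc {k : ℕ} (hk : 0 < k) {R t₀ α : ℝ} (hR : 0 < R)
    (p : Fin (2 * k + 1) → ℤ × ℤ) (hp : Function.Injective p)
    (hpt : ∀ i, ∃ t ∈ Set.Icc t₀ (t₀ + α),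
      ((p i).1 : ℝ) = R * cos t ∧ ((p i).2 : ℝ) = R * sin t) :
    R ^ (2 * k) < (R ^ 2 * α ^ 2) ^ (2 * k + 1) := by
  choose t ht hx hy using hpt
  let z : Fin (2 * k + 1) → GaussianInt := fun i ↦ ⟨(p i).1, (p i).2⟩
  have hz : Function.Injective z := fun i j h ↦
    hp (Prod.ext (congrArg Zsqrtd.re h) (congrArg Zsqrtd.im h))
  have hnorm (i) : ((z i).norm : ℝ) = R ^ 2 := by
    simp only [z, Zsqrtd.norm_def]
    push_cast
    rw [hx, hy]
    linear_combination R ^ 2 * sin_sq_add_cos_sq (t i)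
  have hn : (((z 0).norm : ℤ) : ℝ) = R ^ 2 := hnorm 0
  have hzn (i) : (z i).norm = (z 0).norm := by
    exact_mod_cast (hnorm i).trans hn.symm
  have hn0 : 0 < (z 0).norm := by
    have : (0 : ℝ) < ((z 0).norm : ℤ) := by rw [hn]; positivity
    exact_mod_cast this
  have hlt {i j} (hij : i < j) : ((z j - z i).norm : ℝ) < R ^ 2 * α ^ 2 := by
    have hts : t i ≠ t j := by
      intro h
      refine hij.ne (hp (Prod.ext ?_ ?_))
      · exact Int.cast_injective (α := ℝ) (by rw [hx, hx, h])
      · exact Int.cast_injective (α := ℝ) (by rw [hy, hy, h])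
    have habs : |t j - t i| ≤ α := by
      obtain ⟨h1, h2⟩ := ht i
      obtain ⟨h3, h4⟩ := ht j
      rw [abs_le]
      constructor <;> linarith
    calc ((z j - z i).norm : ℝ)
        = (R * cos (t j) - R * cos (t i)) ^ 2 + (R * sin (t j) - R * sin (t i)) ^ 2 := by
          simp only [z, Zsqrtd.norm_def, Zsqrtd.re_sub, Zsqrtd.im_sub]
          push_cast
          rw [hx, hy, hx, hy]
          ring
      _ < R ^ 2 * (t j - t i) ^ 2 := Real.sq_chord_lt_sq_arc hR.ne' hts
      _ ≤ R ^ 2 * α ^ 2 := by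
          rw [← sq_abs (t j - t i)]
          gcongr
  have hpos {i j} (hij : i < j) : (0 : ℝ) < ((z j - z i).norm : ℝ) := by
    have : 0 < (z j - z i).norm :=
      GaussianInt.norm_pos.mpr (sub_ne_zero.mpr (hz.ne hij.ne'))
    exact_mod_cast this
  have hmain : (R ^ 2) ^ (k ^ 2) ≤ ∏ i, ∏ j ∈ Finset.Ioi i, ((z j - z i).norm : ℝ) := by
    have := GaussianInt.norm_pow_sq_le_prod_norm_sub hn0 z hz hzn
    rw [← hn]
    exact_mod_cast this
  have hprod : ∏ i, ∏ j ∈ Finset.Ioi i, ((z j - z i).norm : ℝ) <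
      (R ^ 2 * α ^ 2) ^ (k * (2 * k + 1)) := by
    have hexp : ∑ i : Fin (2 * k + 1), (Finset.Ioi i).card = k * (2 * k + 1) := by
      simp only [Fin.card_Ioi]
      rw [Fin.sum_univ_eq_sum_range (fun j ↦ 2 * k + 1 - 1 - j),
        Finset.sum_range_reflect (fun j ↦ j)]
      have := Finset.sum_range_id_mul_two (2 * k + 1)
      rw [Nat.add_sub_cancel] at this
      linarith
    rw [← hexp, ← Finset.prod_pow_eq_pow_sum]
    simp only [← Finset.prod_const]
    rw [Finset.prod_sigma', Finset.prod_sigma']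
    refine Finset.prod_lt_prod_of_nonempty (fun x hx ↦ hpos ?_) (fun x hx ↦ hlt ?_) ?_
    · simpa using hx
    · simpa using hx
    · exact ⟨⟨0, ⟨1, by omega⟩⟩, by simp⟩
  refine lt_of_pow_lt_pow_left₀ k (by positivity) ?_
  calc (R ^ (2 * k)) ^ k = (R ^ 2) ^ (k ^ 2) := by rw [← pow_mul, ← pow_mul]; ring_nf
    _ < _ := hmain.trans_lt hprod
    _ = _ := by rw [← pow_mul]; ring_nf

/-- The theorem of Cilleruelo and Córdoba: for every `δ > 0` there is `k(δ)` such that every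
arc of the circle of radius `R ≥ 1` of angular aperture at most `R^{-1/2-δ}` (equivalently,
of arclength at most `R^{1/2-δ}`) contains at most `k(δ)` lattice points of `ℤ²`. -/
theorem cilleruelo_cordoba_arcs :
    ∀ δ : ℝ, 0 < δ → ∃ k : ℕ,
      ∀ R : ℝ, 1 ≤ R → ∀ t₀ α : ℝ, 0 ≤ α → α ≤ R ^ (-(1 / 2 : ℝ) - δ) →
        ({ℓ : ℤ × ℤ | ∃ t ∈ Set.Icc t₀ (t₀ + α),
            (ℓ.1 : ℝ) = R * Real.cos t ∧ (ℓ.2 : ℝ) = R * Real.sin t}).Finite ∧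
        ({ℓ : ℤ × ℤ | ∃ t ∈ Set.Icc t₀ (t₀ + α),
            (ℓ.1 : ℝ) = R * Real.cos t ∧ (ℓ.2 : ℝ) = R * Real.sin t}).ncard ≤ k := by
  intro δ hδ
  obtain ⟨m, hm⟩ := exists_nat_gt (1 / δ)
  have hm0 : 0 < m := by
    have : (0 : ℝ) < m := lt_trans (by positivity) hm
    exact_mod_cast this
  refine ⟨2 * m, fun R hR t₀ α hα hαR ↦ ?_⟩
  rw [← Set.encard_le_coe_iff_finite_ncard_le]
  by_contra! hcard
  obtain ⟨s, hs, hsc⟩ := Set.exists_subset_encard_eq (Order.add_one_le_of_lt hcard)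
  have hsfin : s.Finite := Set.finite_of_encard_eq_coe (k := 2 * m + 1) (by exact_mod_cast hsc)
  have : Fintype s := hsfin.fintype
  have hcs : Fintype.card s = 2 * m + 1 := by
    rw [← Set.coe_fintypeCard] at hsc
    exact_mod_cast hsc
  let e := (Fintype.equivFinOfCardEq hcs).symm
  have hR0 : 0 < R := by linarith
  have hlt := lt_pow_of_lattice_points_on_arc hm0 hR0 (fun i ↦ (e i : ℤ × ℤ))
    (Subtype.val_injective.comp e.injective) (fun i ↦ hs (e i).2)
  refine hlt.not_ge ?_
  calc (R ^ 2 * α ^ 2) ^ (2 * m + 1)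
      ≤ (R ^ 2 * (R ^ (-(1 / 2 : ℝ) - δ)) ^ 2) ^ (2 * m + 1) := by gcongr
    _ = R ^ ((1 - 2 * δ) * (2 * m + 1)) := by
        rw [← rpow_natCast, ← rpow_natCast, ← rpow_natCast, ← rpow_mul hR0.le,
          ← rpow_add hR0, ← rpow_mul hR0.le]
        congr 1
        push_cast
        ring
    _ ≤ R ^ ((2 * m : ℕ) : ℝ) := by
        refine rpow_le_rpow_of_exponent_le hR ?_
        rw [div_lt_iff₀ hδ] at hm
        push_cast
        nlinarith
    _ = R ^ (2 * m) := rpow_natCast _ _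

end
end
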